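/- arXiv:1508.06035 — 2 statements merged into one kernel-verified Lean document; each statement's English description precedes it below -/
import Mathlib

section
/- For every pair of points z₀, z₁ ∈ ℝ² and every ρ > 0 there exists a constant l₀ ∈ ℝ such that ∫_{{z : ‖z − z₁‖ ≤ ρ}} ( log‖z − z₀‖ − l₀ )² dz ≤ 9 π ρ². -/
open MeasureTheory

lemma aux_bound (R y : ℝ) (hR : 0 < R) (hy : 0 < y) (hyR : y ≤ R) :
    ‖y * (Real.log y - Real.log R) ^ 2‖ ≤ 18 / 25 * R := by
  rw [Real.norm_of_nonneg (by positivity)]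
  set L := Real.log y - Real.log R with hL
  have hL0 : L ≤ 0 := by
    have := Real.log_le_log hy hyR
    linarith
  have hyL : y = R * Real.exp L := by
    rw [hL, Real.exp_sub, Real.exp_log hy, Real.exp_log hR]
    field_simp
  have h1 : -L / 2 ≤ Real.exp (-L / 2 - 1) := by
    have := Real.add_one_le_exp (-L / 2 - 1)
    linarith
  have h2 : (-L / 2) ^ 2 ≤ Real.exp (-L / 2 - 1) ^ 2 :=
    pow_le_pow_left₀ (by linarith) h1 2
  have h3 : Real.exp (-L / 2 - 1) ^ 2 * (Real.exp L * Real.exp 1 ^ 2) = 1 := by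
    rw [← Real.exp_nat_mul, ← Real.exp_nat_mul, ← Real.exp_add, ← Real.exp_add,
      Real.exp_eq_one_iff]
    push_cast
    ring
  have h4 : Real.exp L * L ^ 2 * Real.exp 1 ^ 2 ≤ 4 := by
    have := mul_le_mul_of_nonneg_right h2
      (show 0 ≤ Real.exp L * Real.exp 1 ^ 2 by positivity)
    rw [h3] at this
    nlinarith
  have he : 2.7 < Real.exp 1 := by
    have := Real.exp_one_gt_d9
    linarith
  have h5 : Real.exp L * L ^ 2 ≤ 18 / 25 := by
    have h0 : 0 ≤ Real.exp L * L ^ 2 := by positivity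
    have : 7.29 ≤ Real.exp 1 ^ 2 := by nlinarith
    nlinarith
  rw [hyL]
  nlinarith

lemma aux_near (R : ℝ) (hR : 0 < R) :
    Integrable (fun z : EuclideanSpace ℝ (Fin 2) =>
      (Set.Iic R).indicator (fun y => (Real.log y - Real.log R) ^ 2) ‖z‖) ∧
    ∫ z : EuclideanSpace ℝ (Fin 2),
      (Set.Iic R).indicator (fun y => (Real.log y - Real.log R) ^ 2) ‖z‖
        ≤ 36 / 25 * Real.pi * R ^ 2 := by
  have heq : (fun y : ℝ => y ^ (Module.finrank ℝ (EuclideanSpace ℝ (Fin 2)) - 1) •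
      (Set.Iic R).indicator (fun y => (Real.log y - Real.log R) ^ 2) y) =
      (Set.Iic R).indicator (fun y => y * (Real.log y - Real.log R) ^ 2) := by
    funext y
    by_cases h : y ≤ R <;> simp [h]
  have hs : Set.Ioi 0 ∩ Set.Iic R = Set.Ioc 0 R := rfl
  constructor
  · rw [integrable_fun_norm_addHaar, heq, IntegrableOn,
      integrable_indicator_iff measurableSet_Iic, IntegrableOn,
      Measure.restrict_restrict measurableSet_Iic, Set.inter_comm, hs]
    refine IntegrableOn.of_bound (by simp) (by fun_prop) (18 / 25 * R) ?_
    filter_upwards [ae_restrict_mem measurableSet_Ioc] with y hy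
    exact aux_bound R y hR hy.1 hy.2
  · rw [integral_fun_norm_addHaar, heq, setIntegral_indicator measurableSet_Iic, hs]
    have h := norm_setIntegral_le_of_norm_le_const (μ := volume) (s := Set.Ioc 0 R)
      (by simp) (fun y hy => aux_bound R y hR hy.1 hy.2)
    have h' := (Real.le_norm_self _).trans h
    have hv : volume.real (Set.Ioc 0 R) = R := by simp [hR.le]
    have hb : volume.real (Metric.ball (0 : EuclideanSpace ℝ (Fin 2)) 1) = Real.pi := by
      simp [Measure.real, Real.pi_pos.le]
    rw [hv] at h'
    rw [hb]
    simp only [finrank_euclideanSpace, Fintype.card_fin, smul_eq_mul, nsmul_eq_mul]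
    have := mul_le_mul_of_nonneg_left h' Real.pi_pos.le
    push_cast
    nlinarith

/-- **Quantitative BMO property of the logarithm.** For all `z₀, z₁ ∈ ℝ²` and `ρ > 0` there
is a constant `l₀ ∈ ℝ` with `∫_{B_ρ(z₁)} (log‖z − z₀‖ − l₀)² ≤ 9 π ρ²`. -/
theorem log_bmo (z₀ z₁ : EuclideanSpace ℝ (Fin 2)) (ρ : ℝ) (hρ : 0 < ρ) :
    ∃ l₀ : ℝ, ∫ z in Metric.closedBall z₁ ρ, (Real.log ‖z - z₀‖ - l₀) ^ 2 ≤
      9 * Real.pi * ρ ^ 2 := by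
  rcases le_or_gt ‖z₁ - z₀‖ (3 / 2 * ρ) with hd | hd
  · have hR : 0 < 5 / 2 * ρ := by positivity
    obtain ⟨hi, hle⟩ := aux_near (5 / 2 * ρ) hR
    refine ⟨Real.log (5 / 2 * ρ), ?_⟩
    rw [← integral_indicator Metric.isClosed_closedBall.measurableSet]
    rw [← integral_sub_right_eq_self _ z₀] at hle
    refine (integral_mono_of_nonneg ?_ (hi.comp_sub_right z₀) ?_).trans (hle.trans ?_)
    · exact Filter.Eventually.of_forall fun z =>
        Set.indicator_nonneg (fun _ _ => sq_nonneg _) z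
    · refine Filter.Eventually.of_forall fun z => ?_
      by_cases hz : z ∈ Metric.closedBall z₁ ρ
      · have hz' : ‖z - z₀‖ ≤ 5 / 2 * ρ := by
          have h1 : ‖z - z₁‖ ≤ ρ := by simpa [dist_eq_norm] using hz
          have h2 := norm_sub_le_norm_sub_add_norm_sub z z₁ z₀
          linarith
        simp [Set.indicator_of_mem hz, hz']
      · simp only [Set.indicator_of_notMem hz]
        exact Set.indicator_nonneg (fun _ _ => sq_nonneg _) _
    · apply le_of_eq
      ring
  · refine ⟨Real.log ‖z₁ - z₀‖, ?_⟩
    have hd0 : 0 < ‖z₁ - z₀‖ := by nlinarith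
    have hC : ∀ z ∈ Metric.closedBall z₁ ρ,
        ‖(Real.log ‖z - z₀‖ - Real.log ‖z₁ - z₀‖) ^ 2‖ ≤ 9 := by
      intro z hz
      have h1 : ‖z - z₁‖ ≤ ρ := by simpa [dist_eq_norm] using hz
      have h2 := norm_sub_le_norm_sub_add_norm_sub z z₁ z₀
      have h3 := norm_sub_le_norm_sub_add_norm_sub z₁ z z₀
      rw [norm_sub_rev z₁ z] at h3
      have hz0 : 0 < ‖z - z₀‖ := by linarith
      rw [Real.norm_of_nonneg (sq_nonneg _)]
      have h4 := Real.log_le_sub_one_of_pos (div_pos hz0 hd0)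
      have h5 := Real.log_le_sub_one_of_pos (div_pos hd0 hz0)
      rw [Real.log_div hz0.ne' hd0.ne'] at h4
      rw [Real.log_div hd0.ne' hz0.ne'] at h5
      have h6 : ‖z - z₀‖ / ‖z₁ - z₀‖ ≤ 3 := by
        rw [div_le_iff₀ hd0]; linarith
      have h7 : ‖z₁ - z₀‖ / ‖z - z₀‖ ≤ 3 := by
        rw [div_le_iff₀ hz0]; linarith
      nlinarith
    have h := norm_setIntegral_le_of_norm_le_const (μ := volume) (by simp [ENNReal.mul_lt_top_iff]) hC
    refine ((Real.le_norm_self _).trans h).trans (le_of_eq ?_)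
    simp [Measure.real, Real.pi_pos.le, hρ.le]
    ring
end

section
/- Let γ₀ > 0. There is a constant c > 0 depending only on γ₀ with the following property. Let h > 0 and let τ ⊂ ℝ² be a closed triangle (the convex hull of three affinely independent points) with diameter at most h that contains a closed disk of radius γ₀ h, and let z₀ ∈ τ. Then there exists a unique affine function q : ℝ² → ℝ such that ∫_τ q · p dz = p(z₀) for every affine function p : ℝ² → ℝ, and this q satisfies sup_{z ∈ τ} |q(z)| ≤ c h^{-2}. -/
open MeasureTheory
open scoped RealInnerProductSpace

abbrev E2 := EuclideanSpace ℝ (Fin 2)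

lemma dd_int {K : Set E2} (hK : IsCompact K) (b b' : E2) (β β' : ℝ) :
    IntegrableOn (fun z : E2 => (⟪b, z⟫ + β) * (⟪b', z⟫ + β')) K := by
  apply ContinuousOn.integrableOn_compact hK
  fun_prop

lemma dd_unit (b : E2) : ∃ u : E2, ‖u‖ ≤ 1 ∧ ⟪b, u⟫ = ‖b‖ := by
  by_cases hb : b = 0
  · exact ⟨0, by simp, by simp [hb]⟩
  · have hn : ‖b‖ ≠ 0 := by simpa using hb
    refine ⟨(‖b‖)⁻¹ • b, ?_, ?_⟩
    · rw [norm_smul, norm_inv, norm_norm, inv_mul_cancel₀ hn]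
    · rw [real_inner_smul_right, real_inner_self_eq_norm_sq]
      field_simp

lemma dd_point (b y : E2) (β r : ℝ) (hr : 0 < r) :
    ∃ y' : E2, dist y' y ≤ r / 2 ∧ ∀ z ∈ Metric.ball y' (r / 4),
      |⟪b, y⟫ + β| + ‖b‖ * (r / 4) ≤ |⟪b, z⟫ + β| := by
  obtain ⟨u, hu, hbu⟩ := dd_unit b
  have key : ∀ (w z : E2), z ∈ Metric.ball w (r / 4) →
      |⟪b, z⟫ - ⟪b, w⟫| ≤ ‖b‖ * (r / 4) := by
    intro w z hz
    rw [← inner_sub_right]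
    refine (abs_real_inner_le_norm _ _).trans ?_
    rw [Metric.mem_ball, dist_eq_norm] at hz
    gcongr
  have hd : ‖(r / 2) • u‖ ≤ r / 2 := by
    rw [norm_smul, Real.norm_of_nonneg (by positivity)]
    nlinarith
  rcases le_total 0 (⟪b, y⟫ + β) with h | h
  · refine ⟨y + (r / 2) • u, by simpa [dist_eq_norm] using hd, fun z hz => ?_⟩
    have := abs_le.1 (key _ z hz)
    rw [inner_add_right, real_inner_smul_right, hbu] at this
    rw [abs_of_nonneg h]
    refine le_trans ?_ (le_abs_self _)
    nlinarith [this.1]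
  · refine ⟨y - (r / 2) • u, by simpa [dist_eq_norm] using hd, fun z hz => ?_⟩
    have := abs_le.1 (key _ z hz)
    rw [inner_sub_right, real_inner_smul_right, hbu] at this
    rw [abs_of_nonpos h]
    refine le_trans ?_ (neg_le_abs _)
    nlinarith [this.2]

lemma dd_coer {K : Set E2} (hK : IsCompact K) (b y : E2) (β r : ℝ) (hr : 0 < r)
    (hy : Metric.closedBall y r ⊆ K) :
    (Real.pi * r ^ 2 / 16) * (|⟪b, y⟫ + β| + ‖b‖ * (r / 4)) ^ 2 ≤
      ∫ z in K, (⟪b, z⟫ + β) * (⟪b, z⟫ + β) := by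
  obtain ⟨y', hy', H⟩ := dd_point b y β r hr
  have hsub : Metric.ball y' (r / 4) ⊆ K := by
    refine Set.Subset.trans (fun z hz => ?_) hy
    rw [Metric.mem_ball] at hz
    rw [Metric.mem_closedBall]
    linarith [dist_triangle z y' y]
  have hv : volume.real (Metric.ball y' (r / 4)) = Real.pi * r ^ 2 / 16 := by
    rw [Measure.real, EuclideanSpace.volume_ball_fin_two, ← ENNReal.ofReal_pow (by positivity),
      ENNReal.toReal_mul, ENNReal.toReal_ofReal (by positivity)]
    rw [ENNReal.toReal_ofReal Real.pi_pos.le]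
    ring
  calc (Real.pi * r ^ 2 / 16) * (|⟪b, y⟫ + β| + ‖b‖ * (r / 4)) ^ 2
      = ∫ z in Metric.ball y' (r / 4), (|⟪b, y⟫ + β| + ‖b‖ * (r / 4)) ^ 2 := by
        rw [setIntegral_const, hv, smul_eq_mul]
    _ ≤ ∫ z in Metric.ball y' (r / 4), (⟪b, z⟫ + β) * (⟪b, z⟫ + β) := by
        apply setIntegral_mono_on
        · exact integrableOn_const Metric.isBounded_ball.measure_lt_top.ne
        · exact (dd_int hK b b β β).mono_set hsub
        · exact measurableSet_ball
        · intro z hz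
          rw [← abs_mul_abs_self, ← sq]
          have := H z hz
          gcongr
    _ ≤ _ := by
        apply setIntegral_mono_set (dd_int hK b b β β)
        · exact Filter.Eventually.of_forall fun z => mul_self_nonneg _
        · exact Filter.Eventually.of_forall hsub

/-- the bilinear form on pairs -/
noncomputable def ddT {K : Set E2} (hK : IsCompact K) :
    (E2 × ℝ) →ₗ[ℝ] (E2 × ℝ) →ₗ[ℝ] ℝ :=
  LinearMap.mk₂ ℝ (fun q p => ∫ z in K, (⟪q.1, z⟫ + q.2) * (⟪p.1, z⟫ + p.2))
    (by
      intro a a' p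
      rw [← integral_add (dd_int hK _ _ _ _) (dd_int hK _ _ _ _)]
      congr 1; ext z
      simp only [Prod.fst_add, Prod.snd_add, inner_add_left]; ring)
    (by
      intro c a p
      rw [smul_eq_mul, ← integral_const_mul]
      congr 1; ext z
      simp only [Prod.smul_fst, Prod.smul_snd, real_inner_smul_left, smul_eq_mul]; ring)
    (by
      intro p a a'
      rw [← integral_add (dd_int hK _ _ _ _) (dd_int hK _ _ _ _)]
      congr 1; ext z
      simp only [Prod.fst_add, Prod.snd_add, inner_add_left]; ring)
    (by
      intro c a p
      rw [smul_eq_mul, ← integral_const_mul]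
      congr 1; ext z
      simp only [Prod.smul_fst, Prod.smul_snd, real_inner_smul_left, smul_eq_mul]; ring)

lemma ddT_apply {K : Set E2} (hK : IsCompact K) (q p : E2 × ℝ) :
    ddT hK q p = ∫ z in K, (⟪q.1, z⟫ + q.2) * (⟪p.1, z⟫ + p.2) := rfl

lemma ddT_inj {K : Set E2} (hK : IsCompact K) (y : E2) (r : ℝ) (hr : 0 < r)
    (hy : Metric.closedBall y r ⊆ K) : Function.Injective (ddT hK) := by
  rw [injective_iff_map_eq_zero]
  rintro ⟨b, β⟩ h
  have h1 := dd_coer hK b y β r hr hy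
  have h2 := ddT_apply hK (b, β) (b, β)
  rw [h] at h2
  simp only [LinearMap.zero_apply] at h2
  rw [← h2] at h1
  have hpos : 0 < Real.pi * r ^ 2 / 16 := by positivity
  have h3 : |⟪b, y⟫ + β| + ‖b‖ * (r / 4) = 0 := by
    have : (|⟪b, y⟫ + β| + ‖b‖ * (r / 4)) ^ 2 ≤ 0 := by
      by_contra hc
      push Not at hc
      nlinarith [mul_pos hpos hc]
    exact pow_eq_zero_iff (two_ne_zero) |>.1 (le_antisymm this (sq_nonneg _))
  have hb : b = 0 := by
    rw [← norm_eq_zero]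
    have := norm_nonneg b
    have := abs_nonneg (⟪b, y⟫ + β)
    by_contra hc
    have : 0 < ‖b‖ * (r / 4) := by positivity
    linarith
  subst hb
  simpa using h3

lemma ddT_surj {K : Set E2} (hK : IsCompact K) (y : E2) (r : ℝ) (hr : 0 < r)
    (hy : Metric.closedBall y r ⊆ K) : Function.Surjective (ddT hK) := by
  refine (LinearMap.injective_iff_surjective_of_finrank_eq_finrank ?_).1 (ddT_inj hK y r hr hy)
  exact (Subspace.dual_finrank_eq (K := ℝ) (V := E2 × ℝ)).symm

/-- **The discrete delta function on a quasi-uniform triangle.** On a triangle `τ ⊂ ℝ²` of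
diameter at most `h` containing a disk of radius `γ₀ h`, for every `z₀ ∈ τ` there is a unique
affine function `q` with `∫_τ q p = p(z₀)` for all affine `p`, and `sup_τ |q| ≤ c h^{-2}` with
`c` depending only on `γ₀`. -/
theorem discrete_delta (γ₀ : ℝ) (hγ₀ : 0 < γ₀) :
    ∃ c > 0, ∀ h : ℝ, 0 < h →
      ∀ A B C : EuclideanSpace ℝ (Fin 2),
        AffineIndependent ℝ ![A, B, C] →
        Metric.diam (convexHull ℝ {A, B, C}) ≤ h →
        (∃ y : EuclideanSpace ℝ (Fin 2),
          Metric.closedBall y (γ₀ * h) ⊆ convexHull ℝ {A, B, C}) →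
        ∀ z₀ ∈ convexHull ℝ {A, B, C},
          (∃! q : EuclideanSpace ℝ (Fin 2) → ℝ,
            (∃ (b : EuclideanSpace ℝ (Fin 2)) (β : ℝ), q = fun z => ⟪b, z⟫ + β) ∧
            ∀ p : EuclideanSpace ℝ (Fin 2) → ℝ,
              (∃ (b : EuclideanSpace ℝ (Fin 2)) (β : ℝ), p = fun z => ⟪b, z⟫ + β) →
              (∫ z in convexHull ℝ {A, B, C}, q z * p z) = p z₀) ∧
          ∀ q : EuclideanSpace ℝ (Fin 2) → ℝ,
            ((∃ (b : EuclideanSpace ℝ (Fin 2)) (β : ℝ), q = fun z => ⟪b, z⟫ + β) ∧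
              ∀ p : EuclideanSpace ℝ (Fin 2) → ℝ,
                (∃ (b : EuclideanSpace ℝ (Fin 2)) (β : ℝ), p = fun z => ⟪b, z⟫ + β) →
                (∫ z in convexHull ℝ {A, B, C}, q z * p z) = p z₀) →
            ∀ z ∈ convexHull ℝ {A, B, C}, |q z| ≤ c / h ^ 2 := by
  refine ⟨16 * (1 + 4 / γ₀) ^ 2 / (Real.pi * γ₀ ^ 2), by positivity, ?_⟩
  rintro h hh A B C - hdiam ⟨y, hy⟩ z₀ hz₀
  have hK : IsCompact (convexHull ℝ ({A, B, C} : Set E2)) :=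
    (Set.toFinite ({A, B, C} : Set E2)).isCompact_convexHull ℝ
  generalize convexHull ℝ ({A, B, C} : Set E2) = K at *
  have hr : 0 < γ₀ * h := by positivity
  have hyK : y ∈ K := hy (Metric.mem_closedBall_self hr.le)
  refine ⟨?_, ?_⟩
  · let L : (E2 × ℝ) →ₗ[ℝ] ℝ :=
      ((innerSL ℝ z₀).toLinearMap).coprod LinearMap.id
    obtain ⟨⟨b, β⟩, hq⟩ := ddT_surj hK y _ hr hy L
    refine ⟨fun z => ⟪b, z⟫ + β, ⟨⟨b, β, rfl⟩, ?_⟩, ?_⟩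
    · rintro p ⟨b', β', rfl⟩
      have := LinearMap.congr_fun hq (b', β')
      rw [ddT_apply] at this
      simpa [L, real_inner_comm] using this
    · rintro q ⟨⟨b', β', rfl⟩, H⟩
      have : (b', β') = (b, β) := by
        apply ddT_inj hK y _ hr hy
        rw [hq]
        apply LinearMap.ext
        rintro ⟨b'', β''⟩
        rw [ddT_apply]
        have := H _ ⟨b'', β'', rfl⟩
        simpa [L, real_inner_comm] using this
      obtain ⟨rfl, rfl⟩ := Prod.mk.inj this
      rfl
  · rintro q ⟨⟨b, β, rfl⟩, H⟩ z hz
    have h1 := dd_coer hK b y β _ hr hy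
    have h2 := H _ ⟨b, β, rfl⟩
    simp only at h2
    rw [h2] at h1
    set s := |⟪b, y⟫ + β| + ‖b‖ * (γ₀ * h / 4) with hs
    have hs0 : 0 ≤ s := by positivity
    have key : ∀ w ∈ K, |⟪b, w⟫ + β| ≤ (1 + 4 / γ₀) * s := by
      intro w hw
      have e : ⟪b, w⟫ + β = (⟪b, y⟫ + β) + ⟪b, w - y⟫ := by
        rw [inner_sub_right]; ring
      have e1 : |⟪b, w - y⟫| ≤ ‖b‖ * h := by
        refine (abs_real_inner_le_norm _ _).trans ?_
        gcongr
        rw [← dist_eq_norm]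
        exact (Metric.dist_le_diam_of_mem hK.isBounded hw hyK).trans hdiam
      have e2 : (1 + 4 / γ₀) * s = |⟪b, y⟫ + β| + ‖b‖ * h
          + (4 / γ₀ * |⟪b, y⟫ + β| + ‖b‖ * (γ₀ * h / 4)) := by
        rw [hs]; field_simp; ring
      have e3 : 0 ≤ 4 / γ₀ * |⟪b, y⟫ + β| + ‖b‖ * (γ₀ * h / 4) := by positivity
      rw [e2, e]
      linarith [abs_add_le (⟪b, y⟫ + β) ⟪b, w - y⟫]
    have h3 := (le_abs_self _).trans (key z₀ hz₀)
    have hk : 0 < 1 + 4 / γ₀ := by positivity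
    have h4 : Real.pi * (γ₀ * h) ^ 2 / 16 * s ≤ 1 + 4 / γ₀ := by
      rcases hs0.eq_or_lt with h0 | h0
      · rw [← h0]; simpa using hk.le
      · refine le_of_mul_le_mul_right ?_ h0
        linarith [h1.trans h3]
    refine (key z hz).trans ?_
    have h5 : s ≤ (1 + 4 / γ₀) / (Real.pi * (γ₀ * h) ^ 2 / 16) := by
      rw [le_div_iff₀ (by positivity)]; linarith
    calc (1 + 4 / γ₀) * s ≤ (1 + 4 / γ₀) * ((1 + 4 / γ₀) / (Real.pi * (γ₀ * h) ^ 2 / 16)) := by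
          gcongr
      _ = _ := by
          generalize 1 + 4 / γ₀ = k
          field_simp
end
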